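/- Fix integers N ≥ 2, l with 2 ≤ l ≤ N, and k ≥ 1, and set M = k·(2^N − 2^{N−l+1}) and n = k·2^{N−l}. If H is a real M×M matrix with H ∈ IH(N,l,k) and E is a real M×n matrix with E ∈ ED(N,l,k), then the product H·E satisfies H·E ∈ ED(N,l,k). -/

import Mathlib

/-- The block index `⌈i/k⌉` of a 1-based entry index `i`, expressed for the
0-based index `v = i - 1` as `v / k + 1`. -/
def blk (k v : ℕ) : ℕ := v / k + 1

/-- `E` has the elongated dyadic diagonal block-sparsity pattern `ED(N,l,k)`:
`E_{ij} = 0` unless the block indices `p = ⌈i/k⌉`, `q = ⌈j/k⌉` satisfy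
`(q-1)(2^l - 2) < p ≤ q(2^l - 2)`. -/
def IsED (l k : ℕ) {M n : ℕ} (E : Matrix (Fin M) (Fin n) ℝ) : Prop :=
  ∀ (i : Fin M) (j : Fin n),
    ¬ ((blk k j.val - 1) * (2 ^ l - 2) < blk k i.val ∧
        blk k i.val ≤ blk k j.val * (2 ^ l - 2)) → E i j = 0

/-- Membership `(p,q) ∈ 𝐈_m`: `1 ≤ p,q ≤ 2^m - 1` and `|q - p| < 2^(ν(p))`,
where `ν(p)` is the 2-adic valuation of `p`. -/
def dyadIdx (m p q : ℕ) : Prop :=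
  1 ≤ p ∧ p ≤ 2 ^ m - 1 ∧ 1 ≤ q ∧ q ≤ 2 ^ m - 1 ∧
    |(q : ℤ) - (p : ℤ)| < 2 ^ (padicValNat 2 p)

/-- `H` is level-`l` incomplete horizontally dyadic, `H ∈ IH(N,l,k)`. -/
def IsIH (N l k : ℕ) {M : ℕ} (H : Matrix (Fin M) (Fin M) ℝ) : Prop :=
  ∀ i j : Fin M,
    ¬ (∃ r, 1 ≤ r ∧ r ≤ 2 ^ (N - l + 1) ∧
        (r - 1) * (2 ^ (l - 1) - 1) + 1 ≤ blk k i.val ∧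
        blk k i.val ≤ (r - 1) * (2 ^ (l - 1) - 1) + 2 ^ (l - 1) - 1 ∧
        (r - 1) * (2 ^ (l - 1) - 1) + 1 ≤ blk k j.val ∧
        blk k j.val ≤ (r - 1) * (2 ^ (l - 1) - 1) + 2 ^ (l - 1) - 1 ∧
        dyadIdx (l - 1) (blk k i.val - (r - 1) * (2 ^ (l - 1) - 1))
          (blk k j.val - (r - 1) * (2 ^ (l - 1) - 1))) → H i j = 0

/-- Cells `(c * s, (c + 1) * s]` refine cells `(q * (2 * s), (q + 1) * (2 * s)]`: a cell of the
first kind that meets a cell of the second kind is contained in it. -/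
theorem mem_double_cell_of_common_cell {s c q p p' : ℕ}
    (hp : c * s < p) (hps : p ≤ (c + 1) * s) (hp' : c * s < p') (hps' : p' ≤ (c + 1) * s)
    (hq : q * (2 * s) < p') (hqs : p' ≤ (q + 1) * (2 * s)) :
    q * (2 * s) < p ∧ p ≤ (q + 1) * (2 * s) := by
  have hlow : 2 * q < c + 1 := by
    refine lt_of_mul_lt_mul_right (a := s) ?_ (Nat.zero_le s)
    linarith
  have hupp : c < 2 * (q + 1) := by
    refine lt_of_mul_lt_mul_right (a := s) ?_ (Nat.zero_le s)
    linarith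
  have hlow' : 2 * q * s ≤ c * s := Nat.mul_le_mul_right s (by omega)
  have hupp' : (c + 1) * s ≤ 2 * (q + 1) * s := Nat.mul_le_mul_right s (by omega)
  constructor <;> linarith

/-- If `H ∈ IH(N,l,k)` and `E ∈ ED(N,l,k)`, then `H·E ∈ ED(N,l,k)`. -/
theorem IH_mul_ED (N l k : ℕ) (hN : 2 ≤ N) (hl2 : 2 ≤ l) (hlN : l ≤ N) (hk : 1 ≤ k)
    (H : Matrix (Fin (k * (2 ^ N - 2 ^ (N - l + 1)))) (Fin (k * (2 ^ N - 2 ^ (N - l + 1)))) ℝ)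
    (E : Matrix (Fin (k * (2 ^ N - 2 ^ (N - l + 1)))) (Fin (k * 2 ^ (N - l))) ℝ)
    (hH : IsIH N l k H) (hE : IsED l k E) : IsED l k (H * E) := by
  intro i j hij
  rw [Matrix.mul_apply]
  refine Finset.sum_eq_zero fun m _ => ?_
  by_contra hne
  obtain ⟨hHne, hEne⟩ := mul_ne_zero_iff.mp hne
  obtain ⟨r, -, -, hi, hi', hm, hm', -⟩ := not_imp_comm.mp (hH i m) hHne
  obtain ⟨hq, hq'⟩ := not_imp_comm.mp (hE m j) hEne
  have hpow : 2 ^ l - 2 = 2 * (2 ^ (l - 1) - 1) := by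
    obtain ⟨t, rfl⟩ : ∃ t, l = t + 1 := ⟨l - 1, by omega⟩
    rw [Nat.add_sub_cancel, pow_succ]
    omega
  have hpos : 1 ≤ 2 ^ (l - 1) := Nat.one_le_two_pow
  rw [Nat.add_sub_assoc hpos, ← Nat.succ_mul] at hi' hm'
  apply hij
  rw [hpow] at hq hq' ⊢
  exact mem_double_cell_of_common_cell (q := j.val / k) hi hi' hm hm' hq hq'
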